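/- The fullerene nanodisc D_3 (with its twelve pentagons arranged in six consecutive pairs) is a 3-regular graph and its girth equals 5. -/

import Mathlib

/-- The vertices of the fullerene nanodisc `D_3` (with pentagons in pairs): the
outer 6-cycle `O`, the 18-cycle `A`, the two central 30-cycles `B` and `Bp` (= B′),
the 18-cycle `Ap` (= A′), and the inner 6-cycle `I`. -/
inductive D3V
  | O : ZMod 6 → D3V
  | A : ZMod 18 → D3V
  | B : ZMod 30 → D3V
  | Bp : ZMod 30 → D3V
  | Ap : ZMod 18 → D3V
  | I : ZMod 6 → D3V
  deriving DecidableEq, Fintype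

/-- The 12 radial edges between an 18-cycle and a 30-cycle of `D_3`, pairing in
increasing cyclic order the vertices `k` with `k ≢ 0 (mod 3)` with the vertices `m`
with `m mod 5 ∈ {0, 3}`. -/
def d3ABRel (k : ZMod 18) (m : ZMod 30) : Bool :=
  (k == 1 && m == 0) || (k == 2 && m == 3) || (k == 4 && m == 5) || (k == 5 && m == 8) ||
  (k == 7 && m == 10) || (k == 8 && m == 13) || (k == 10 && m == 15) || (k == 11 && m == 18) ||
  (k == 13 && m == 20) || (k == 14 && m == 23) || (k == 16 && m == 25) || (k == 17 && m == 28)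

open D3V in
/-- The adjacency generating relation of `D_3` (with pentagons in pairs): the six
cycles, the outer radial edges `O_i — A_{3i}`, the inner radial edges `I_i — A′_{3i}`,
the 12 radial edges between `A` and `B` and the 12 radial edges between `A′` and `B′`
(following the identical pattern), and the 18 central radial edges `B_k — B′_{k+3}`
for `k mod 5 ∈ {1, 4}` and `B_k — B′_{k+4}` for `k mod 5 = 2`. -/
def d3Rel : D3V → D3V → Bool
  | O i, O j => j == i + 1
  | A k, A l => l == k + 1
  | B m, B l => l == m + 1
  | Bp m, Bp l => l == m + 1
  | Ap k, Ap l => l == k + 1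
  | I i, I j => j == i + 1
  | O i, A k => k == (3 * i.val : ZMod 18)
  | I i, Ap k => k == (3 * i.val : ZMod 18)
  | A k, B m => d3ABRel k m
  | Ap k, Bp m => d3ABRel k m
  | B k, Bp l => ((k.val % 5 == 1 || k.val % 5 == 4) && l == k + 3) ||
      (k.val % 5 == 2 && l == k + 4)
  | _, _ => false

/-- The fullerene nanodisc `D_3` with its twelve pentagons arranged in six
consecutive pairs. -/
def D3 : SimpleGraph D3V := SimpleGraph.fromRel (fun a b => d3Rel a b = true)

instance : DecidableRel D3.Adj := fun a b =>
  decidable_of_iff _ (SimpleGraph.fromRel_adj _ a b).symm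

namespace D3V

/-- The neighbour of a vertex of `D_3` along its radial edge. -/
def radial : D3V → D3V
  | O i => A (3 * i.val : ℕ)
  | A k => match k.val % 3 with
    | 0 => O (k.val / 3 : ℕ)
    | 1 => B (5 * (k.val / 3) : ℕ)
    | _ => B (5 * (k.val / 3) + 3 : ℕ)
  | B m => match m.val % 5 with
    | 0 => A (3 * (m.val / 5) + 1 : ℕ)
    | 3 => A (3 * (m.val / 5) + 2 : ℕ)
    | 2 => Bp (m + 4)
    | _ => Bp (m + 3)
  | Bp m => match m.val % 5 with
    | 0 => Ap (3 * (m.val / 5) + 1 : ℕ)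
    | 3 => Ap (3 * (m.val / 5) + 2 : ℕ)
    | 1 => B (m - 4)
    | _ => B (m - 3)
  | Ap k => match k.val % 3 with
    | 0 => I (k.val / 3 : ℕ)
    | 1 => Bp (5 * (k.val / 3) : ℕ)
    | _ => Bp (5 * (k.val / 3) + 3 : ℕ)
  | I i => Ap (3 * i.val : ℕ)

/-- The successor of a vertex of `D_3` on its concentric cycle. -/
def next : D3V → D3V
  | O i => O (i + 1)
  | A k => A (k + 1)
  | B m => B (m + 1)
  | Bp m => Bp (m + 1)
  | Ap k => Ap (k + 1)
  | I i => I (i + 1)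

/-- The predecessor of a vertex of `D_3` on its concentric cycle. -/
def prev : D3V → D3V
  | O i => O (i - 1)
  | A k => A (k - 1)
  | B m => B (m - 1)
  | Bp m => Bp (m - 1)
  | Ap k => Ap (k - 1)
  | I i => I (i - 1)

/-- The three neighbours of a vertex of `D_3`. -/
def nbrs (v : D3V) : List D3V := [v.next, v.prev, v.radial]

theorem nodup_nbrs (v : D3V) : v.nbrs.Nodup := by
  revert v
  decide +kernel

/-- Two neighbours of a vertex have no common neighbour but that vertex. -/
theorem eq_of_mem_nbrs {v a b w : D3V} (ha : a ∈ v.nbrs) (hb : b ∈ v.nbrs) (hab : a ≠ b)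
    (hwa : w ∈ a.nbrs) (hwb : w ∈ b.nbrs) : w = v := by
  have h : ∀ v : D3V, v.nbrs.all fun a => v.nbrs.all fun b =>
      a = b || a.nbrs.all fun w => b.nbrs.all fun x => w ≠ x || w = v := by
    decide +kernel
  simp only [List.all_eq_true, Bool.or_eq_true, decide_eq_true_eq] at h
  exact (((h v a ha b hb).resolve_left hab) w hwa w hwb).resolve_left (not_not.2 rfl)

theorem notMem_nbrs {v a b : D3V} (ha : a ∈ v.nbrs) (hb : b ∈ v.nbrs) : b ∉ a.nbrs := by
  have h : ∀ v : D3V, v.nbrs.all fun a => v.nbrs.all fun b => a.nbrs.all (· ≠ b) := by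
    decide +kernel
  simp only [List.all_eq_true, decide_eq_true_eq] at h
  exact fun hba => h v a ha b hb b hba rfl

theorem d3Rel_of_mem_nbrs {v w : D3V} (hw : w ∈ v.nbrs) :
    v ≠ w ∧ (d3Rel v w = true ∨ d3Rel w v = true) := by
  have h : ∀ v : D3V, v.nbrs.all fun w => v ≠ w && (d3Rel v w || d3Rel w v) := by
    decide +kernel
  simp only [List.all_eq_true, Bool.and_eq_true, Bool.or_eq_true, decide_eq_true_eq] at h
  exact h v w hw

theorem mem_nbrs_of_d3Rel {v w : D3V} (hvw : d3Rel v w = true) : w ∈ v.nbrs ∧ v ∈ w.nbrs := by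
  have h : ∀ v w : D3V, d3Rel v w → v.nbrs.any (· = w) && w.nbrs.any (· = v) := by
    decide +kernel
  simpa using h v w hvw

end D3V

open D3V

theorem D3_adj_iff_mem_nbrs (v w : D3V) : D3.Adj v w ↔ w ∈ v.nbrs := by
  rw [D3, SimpleGraph.fromRel_adj]
  exact ⟨fun h => h.2.elim (fun h => (mem_nbrs_of_d3Rel h).1) fun h => (mem_nbrs_of_d3Rel h).2,
    d3Rel_of_mem_nbrs⟩

theorem D3_degree (v : D3V) : D3.degree v = 3 := by
  have h : D3.neighborFinset v = v.nbrs.toFinset := by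
    ext w
    simp [D3_adj_iff_mem_nbrs]
  rw [← SimpleGraph.card_neighborFinset_eq_degree, h, List.toFinset_card_of_nodup v.nodup_nbrs]
  rfl

theorem five_le_length_of_isCycle_D3 {v : D3V} {w : D3.Walk v v} (hw : w.IsCycle) :
    5 ≤ w.length := by
  have h3 := hw.three_le_length
  by_contra! h5
  match w, hw, h3, h5 with
  | .cons h₁ (.cons h₂ (.cons h₃ .nil)), _, _, _ =>
    rw [D3_adj_iff_mem_nbrs] at h₁ h₂
    exact notMem_nbrs h₁ ((D3_adj_iff_mem_nbrs _ _).1 h₃.symm) h₂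
  | .cons h₁ (.cons h₂ (.cons h₃ (.cons h₄ .nil))), hw, _, _ =>
    have hn := hw.support_nodup
    simp only [SimpleGraph.Walk.support_cons, SimpleGraph.Walk.support_nil, List.tail_cons,
      List.nodup_cons, List.mem_cons, not_or] at hn
    rw [D3_adj_iff_mem_nbrs] at h₁ h₂
    exact hn.2.1.2.1 (eq_of_mem_nbrs h₁ ((D3_adj_iff_mem_nbrs _ _).1 h₄.symm) hn.1.2.1 h₂
      ((D3_adj_iff_mem_nbrs _ _).1 h₃.symm))
  | .cons _ (.cons _ (.cons _ (.cons _ (.cons _ _)))), _, _, h5 =>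
    simp only [SimpleGraph.Walk.length_cons] at h5
    omega

/-- The pentagon `B_1 B_2 B′_6 B′_5 B′_4`. -/
theorem exists_isCycle_length_five_D3 : ∃ w : D3.Walk (B 1) (B 1), w.IsCycle ∧ w.length = 5 := by
  have h₁ : D3.Adj (B 1) (B 2) := by decide +kernel
  have h₂ : D3.Adj (B 2) (Bp 6) := by decide +kernel
  have h₃ : D3.Adj (Bp 6) (Bp 5) := by decide +kernel
  have h₄ : D3.Adj (Bp 5) (Bp 4) := by decide +kernel
  have h₅ : D3.Adj (Bp 4) (B 1) := by decide +kernel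
  refine ⟨.cons h₁ (.cons h₂ (.cons h₃ (.cons h₄ (.cons h₅ .nil)))), ?_, rfl⟩
  rw [SimpleGraph.Walk.cons_isCycle_iff, SimpleGraph.Walk.isPath_def]
  simp only [SimpleGraph.Walk.support_cons, SimpleGraph.Walk.support_nil,
    SimpleGraph.Walk.edges_cons, SimpleGraph.Walk.edges_nil]
  decide +kernel

theorem D3_cubic_girth_five :
    (∀ v : D3V, D3.degree v = 3) ∧ D3.girth = 5 := by
  refine ⟨D3_degree, ?_⟩
  obtain ⟨w, hw, hl⟩ := exists_isCycle_length_five_D3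
  have h : D3.egirth = 5 := le_antisymm
    (by simpa [hl] using SimpleGraph.egirth_le_length hw)
    (SimpleGraph.le_egirth.2 fun _ _ hc => by exact_mod_cast five_le_length_of_isCycle_D3 hc)
  simp [SimpleGraph.girth, h]
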